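/- For every integer n ≥ 1, the map α ↦ s(α) is a bijection from the fiber O_n^{-1}(w_0) (the set of MVP parking functions of length n whose outcome is the decreasing permutation w_0) onto the set of Motzkin step sequences of length n. -/

import Mathlib

open Finset

namespace MVPPark

/-- One step of the MVP parking process: car `c`, preferring spot `p`, arrives at the
state `state` (recording, for each spot, the car parked there, if any).  Car `c` always
parks in spot `p`; if spot `p` was occupied by an (earlier) car `j`, then `j` is bumped
and parks in the first unoccupied spot strictly beyond `p`, if such a spot exists
(otherwise `j` drives off unparked). -/
def mvpStep {n : ℕ} (state : Fin n → Option (Fin n)) (c p : Fin n) :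
    Fin n → Option (Fin n) :=
  match state p with
  | none => Function.update state p (some c)
  | some j =>
    match (List.finRange n).find? (fun k => decide (p < k) && (state k).isNone) with
    | none => Function.update state p (some c)
    | some k => Function.update (Function.update state p (some c)) k (some j)

/-- The final state of the MVP parking process with preference list `α`:
cars `0, 1, …, n-1` enter in order, car `i` preferring spot `α i`. -/
def mvpRun {n : ℕ} (α : Fin n → Fin n) : Fin n → Option (Fin n) :=
  (List.finRange n).foldl (fun st c => mvpStep st c (α c)) (fun _ => none)

/-- `α` is an MVP parking function: under the MVP rule, all `n` cars end up parked. -/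
def IsMVP {n : ℕ} (α : Fin n → Fin n) : Prop :=
  ∀ c : Fin n, ∃ j : Fin n, mvpRun α j = some c

/-- The outcome of the MVP parking process on `α` is the permutation `π`:
for each `j`, spot `j` ends up occupied by car `π j`. -/
def MvpOutcome {n : ℕ} (α : Fin n → Fin n) (π : Equiv.Perm (Fin n)) : Prop :=
  ∀ j : Fin n, mvpRun α j = some (π j)

end MVPPark

namespace MVPPark

/-- `m_j(α)`: the number of cars preferring spot `j` under the preference list `α`. -/
def mcount {n : ℕ} (α : Fin n → Fin n) (j : Fin n) : ℕ :=
  (Finset.univ.filter (fun i => α i = j)).card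

end MVPPark

namespace MVPPark

/-- The step sequence of `α`: `1` at spots preferred by at least two cars, `0` at spots
preferred by exactly one car, and `-1` at spots preferred by no car. -/
def stepSeq {n : ℕ} (α : Fin n → Fin n) (j : Fin n) : ℤ :=
  if 2 ≤ mcount α j then 1 else if mcount α j = 1 then 0 else -1

end MVPPark

namespace MVPPark

variable {n : ℕ}

section Step

variable (S : Fin n → Option (Fin n)) (c p : Fin n)

lemma mvpStep_self : mvpStep S c p p = some c := by
  unfold mvpStep
  rcases S p with _ | j
  · simp
  · rcases hk : (List.finRange n).find? (fun k => decide (p < k) && (S k).isNone) with _ | k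
    · simp
    · have := List.find?_some hk
      have hne : p ≠ k := by
        rintro rfl
        simp at this
      simp [Function.update_of_ne hne]

variable {S c p}

lemma mvpStep_of_ne_none {q : Fin n} (hq : S q ≠ none) (hqp : q ≠ p) :
    mvpStep S c p q = S q := by
  unfold mvpStep
  rcases S p with _ | j
  · simp [hqp]
  · rcases hk : (List.finRange n).find? (fun k => decide (p < k) && (S k).isNone) with _ | k
    · simp [hqp]
    · have := List.find?_some hk
      have hne : q ≠ k := by
        rintro rfl
        simp [hq] at this
      simp [hne, hqp]

lemma eq_some_of_mvpStep_eq_some {z x : Fin n} (hz : z ≠ p) (h : mvpStep S c p z = some x) :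
    S z = some x ∨
      (S z = none ∧ S p = some x ∧ p < z ∧ ∀ q, p < q → q < z → S q ≠ none) := by
  unfold mvpStep at h
  rcases hj : S p with _ | j
  · left; simpa [hz, hj] using h
  · rcases hk : (List.finRange n).find? (fun k => decide (p < k) && (S k).isNone) with _ | k
    · left; simpa [hz, hj, hk] using h
    · simp only [hj, hk] at h
      by_cases hzk : z = k
      · subst hzk
        right
        rw [List.find?_eq_some_iff_append] at hk
        obtain ⟨h1, as, bs, happ, hlt⟩ := hk
        simp only [Bool.and_eq_true, decide_eq_true_eq, Option.isNone_iff_eq_none] at h1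
        refine ⟨h1.2, by simpa [hj] using h, h1.1, fun q hpq hqz hq => ?_⟩
        have hsorted : (as ++ z :: bs).Pairwise (· < ·) := by
          rw [← happ]; exact List.pairwise_lt_finRange n
        have hmem : q ∈ as ++ z :: bs := by rw [← happ]; exact List.mem_finRange q
        rw [List.pairwise_append] at hsorted
        rcases List.mem_append.1 hmem with hm | hm
        · simpa [hpq, hq] using hlt q hm
        · rcases List.mem_cons.1 hm with rfl | hm
          · exact lt_irrefl _ hqz
          · exact lt_asymm hqz ((List.pairwise_cons.1 hsorted.2.1).1 q hm)
      · left; simpa [hz, hzk] using h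

lemma mvpStep_of_eq_some {j k : Fin n} (hj : S p = some j) (hpk : p < k) (hk : S k = none)
    (hq : ∀ q, p < q → q < k → S q ≠ none) :
    mvpStep S c p = Function.update (Function.update S p (some c)) k (some j) := by
  have hfind : (List.finRange n).find? (fun k => decide (p < k) && (S k).isNone) = some k := by
    obtain ⟨as, bs, happ⟩ := List.append_of_mem (List.mem_finRange k)
    rw [List.find?_eq_some_iff_append]
    refine ⟨by simp [hpk, hk], as, bs, happ, fun q hqa => ?_⟩
    have hsorted : (as ++ k :: bs).Pairwise (· < ·) := by
      rw [← happ]; exact List.pairwise_lt_finRange n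
    have hqk : q < k := (List.pairwise_append.1 hsorted).2.2 q hqa k (by simp)
    by_cases hpq : p < q
    · simpa [hpq, Option.isSome_iff_ne_none] using hq q hpq hqk
    · simp [hpq]
  unfold mvpStep
  rw [hj]
  simp only [hfind]

end Step

/-- The state of the MVP parking process after the first `t` cars have entered. -/
def runUpTo (α : Fin n → Fin n) (t : ℕ) : Fin n → Option (Fin n) :=
  ((List.finRange n).take t).foldl (fun st c => mvpStep st c (α c)) (fun _ => none)

lemma runUpTo_zero (α : Fin n → Fin n) : runUpTo α 0 = fun _ => none := rfl

lemma runUpTo_self (α : Fin n → Fin n) : runUpTo α n = mvpRun α := by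
  unfold runUpTo mvpRun
  rw [List.take_of_length_le (by simp)]

lemma runUpTo_succ (α : Fin n → Fin n) (c : Fin n) :
    runUpTo α (c + 1) = mvpStep (runUpTo α c) c (α c) := by
  unfold runUpTo
  rw [List.take_succ_eq_append_getElem (by simp), List.foldl_append]
  simp

section General

variable {α : Fin n → Fin n}

lemma runUpTo_succ_self (c : Fin n) : runUpTo α (c + 1) (α c) = some c := by
  rw [runUpTo_succ, mvpStep_self]

lemma runUpTo_succ_of_ne_none {c q : Fin n} (hq : runUpTo α c q ≠ none) (hne : α c ≠ q) :
    runUpTo α (c + 1) q = runUpTo α c q := by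
  rw [runUpTo_succ, mvpStep_of_ne_none hq hne.symm]

lemma runUpTo_succ_cases {c z x : Fin n} (h : runUpTo α (c + 1) z = some x) :
    (z = α c ∧ x = c) ∨ (z ≠ α c ∧ runUpTo α c z = some x) ∨
      (z ≠ α c ∧ runUpTo α c z = none ∧ runUpTo α c (α c) = some x ∧ α c < z ∧
        ∀ q, α c < q → q < z → runUpTo α c q ≠ none) := by
  by_cases hz : z = α c
  · subst hz
    rw [runUpTo_succ_self] at h
    exact .inl ⟨rfl, (Option.some_injective _ h).symm⟩
  · rw [runUpTo_succ] at h
    rcases eq_some_of_mvpStep_eq_some hz h with h | h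
    · exact .inr (.inl ⟨hz, h⟩)
    · exact .inr (.inr ⟨hz, h⟩)

lemma lt_of_runUpTo_eq_some {t : ℕ} (ht : t ≤ n) {q x : Fin n} (h : runUpTo α t q = some x) :
    x.1 < t := by
  induction t generalizing q with
  | zero => simp [runUpTo_zero] at h
  | succ t ih =>
    rcases runUpTo_succ_cases (c := ⟨t, ht⟩) h with ⟨-, rfl⟩ | ⟨-, h⟩ | ⟨-, -, h, -⟩
    · simp
    · exact (ih (by omega) h).trans (Nat.lt_succ_self t)
    · exact (ih (by omega) h).trans (Nat.lt_succ_self t)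

lemma runUpTo_inj {t : ℕ} (ht : t ≤ n) {q q' x : Fin n} (h : runUpTo α t q = some x)
    (h' : runUpTo α t q' = some x) : q = q' := by
  induction t generalizing q q' with
  | zero => simp [runUpTo_zero] at h
  | succ t ih =>
    have hlt : ∀ {z y}, runUpTo α t z = some y → y.1 < t := lt_of_runUpTo_eq_some (by omega)
    rcases runUpTo_succ_cases (c := ⟨t, ht⟩) h with
      ⟨h1, rfl⟩ | ⟨h1, h2⟩ | ⟨h1, h2, h3, h4, h5⟩ <;>
    rcases runUpTo_succ_cases (c := ⟨t, ht⟩) h' with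
      ⟨h1', h2'⟩ | ⟨h1', h2'⟩ | ⟨h1', h2', h3', h4', h5'⟩
    · rw [h1, h1']
    · exact absurd (hlt h2') (by simp)
    · exact absurd (hlt h3') (by simp)
    · exact absurd (hlt h2) (by simp [h2'])
    · exact ih (by omega) h2 h2'
    · exact absurd (ih (by omega) h2 h3') h1
    · exact absurd (hlt h3) (by simp [h2'])
    · exact absurd (ih (by omega) h2' h3) h1'
    · rcases lt_trichotomy q q' with hq | hq | hq
      · exact absurd h2 (h5' q h4 hq)
      · exact hq
      · exact absurd h2' (h5 q' h4' hq)

lemma runUpTo_ne_none {t t' : ℕ} (htt : t ≤ t') (ht : t' ≤ n) {q : Fin n}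
    (h : runUpTo α t q ≠ none) : runUpTo α t' q ≠ none := by
  induction t', htt using Nat.le_induction with
  | base => exact h
  | succ t' _ ih =>
    by_cases hq : α ⟨t', ht⟩ = q
    · have := runUpTo_succ_self (α := α) ⟨t', ht⟩
      rw [hq] at this
      simp [this]
    · rw [runUpTo_succ_of_ne_none (c := ⟨t', ht⟩) (ih (by omega)) hq]
      exact ih (by omega)

lemma runUpTo_eq_some_of_forall_ne {t t' : ℕ} (htt : t ≤ t') (ht : t' ≤ n) {q x : Fin n}
    (h : runUpTo α t q = some x) (hne : ∀ c : Fin n, t ≤ c.1 → c.1 < t' → α c ≠ q) :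
    runUpTo α t' q = some x := by
  induction t', htt using Nat.le_induction with
  | base => exact h
  | succ t' htt' ih =>
    have ih := ih (by omega) fun c h1 h2 => hne c h1 (by omega)
    rw [runUpTo_succ_of_ne_none (c := ⟨t', ht⟩) (by simp [ih]) (hne ⟨t', ht⟩ htt' (by simp))]
    exact ih

/-- The occupant of a spot can only be replaced by a later car. -/
lemma exists_le_runUpTo {t t' : ℕ} (htt : t ≤ t') (ht : t' ≤ n) {q x : Fin n}
    (h : runUpTo α t q = some x) : ∃ j, x ≤ j ∧ runUpTo α t' q = some j := by
  have hxt := lt_of_runUpTo_eq_some (htt.trans ht) h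
  induction t', htt using Nat.le_induction with
  | base => exact ⟨x, le_rfl, h⟩
  | succ t' htt' ih =>
    obtain ⟨j, hxj, hj⟩ := ih (by omega)
    by_cases hq : α ⟨t', ht⟩ = q
    · refine ⟨⟨t', ht⟩, Fin.le_def.2 (by simp; omega), ?_⟩
      rw [← hq]
      exact runUpTo_succ_self (α := α) ⟨t', ht⟩
    · exact ⟨j, hxj, by rw [runUpTo_succ_of_ne_none (c := ⟨t', ht⟩) (by simp [hj]) hq, hj]⟩

/-- A car that is parked at some time was parked at all earlier times after its arrival. -/
lemma exists_runUpTo_eq_some {t t' : ℕ} (htt : t ≤ t') (ht : t' ≤ n) {q x : Fin n}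
    (h : runUpTo α t' q = some x) (hx : x.1 < t) : ∃ z, runUpTo α t z = some x := by
  induction t', htt using Nat.le_induction generalizing q with
  | base => exact ⟨q, h⟩
  | succ t' htt' ih =>
    rcases runUpTo_succ_cases (c := ⟨t', ht⟩) h with ⟨-, rfl⟩ | ⟨-, h⟩ | ⟨-, -, h, -⟩
    · simp at hx; omega
    · exact ih (by omega) h
    · exact ih (by omega) h

/-- If the spots from `w` up to that of car `x` are all occupied, this remains true forever. -/
lemma runUpTo_block {t t' : ℕ} (htt : t ≤ t') (ht : t' ≤ n) {w x : Fin n} (hx : x.1 < t)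
    (h : ∀ z, runUpTo α t z = some x → w < z ∧ ∀ q, w ≤ q → q ≤ z → runUpTo α t q ≠ none) :
    ∀ z, runUpTo α t' z = some x → w < z ∧ ∀ q, w ≤ q → q ≤ z → runUpTo α t' q ≠ none := by
  induction t', htt using Nat.le_induction with
  | base => exact h
  | succ t' htt' ih =>
    intro z hz
    have hmono : ∀ q, runUpTo α t' q ≠ none → runUpTo α (t' + 1) q ≠ none := fun q hq =>
      runUpTo_ne_none (Nat.le_succ t') ht hq
    rcases runUpTo_succ_cases (c := ⟨t', ht⟩) hz with ⟨-, rfl⟩ | ⟨-, h⟩ | ⟨-, -, h, hlt, hb⟩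
    · simp at hx; omega
    · obtain ⟨h1, h2⟩ := ih (by omega) z h
      exact ⟨h1, fun q hq hq' => hmono q (h2 q hq hq')⟩
    · obtain ⟨h1, h2⟩ := ih (by omega) _ h
      refine ⟨h1.trans hlt, fun q hq hq' => ?_⟩
      rcases eq_or_lt_of_le hq' with rfl | hq'
      · simp [hz]
      · rcases le_or_gt q (α ⟨t', ht⟩) with hqa | hqa
        · exact hmono q (h2 q hq hqa)
        · exact hmono q (hb q hqa hq')

end General

section Fiber

variable {α : Fin n → Fin n}

lemma apply_rev_eq (hα : ∀ j, mvpRun α j = some j.rev) (c : Fin n) :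
    c ≤ (α c).rev ∧ α (α c).rev = α c := by
  obtain ⟨d, hd, hmax⟩ := (univ.filter fun d => α d = α c).exists_max_image id ⟨c, by simp⟩
  simp only [mem_filter, mem_univ, true_and, id] at hd hmax
  have h := runUpTo_eq_some_of_forall_ne (Nat.succ_le_of_lt d.2) le_rfl
    (runUpTo_succ_self (α := α) d) fun e he _ hed => by
      have := Fin.le_def.1 (hmax e (hed.trans hd))
      omega
  rw [runUpTo_self, hα, hd] at h
  rw [Option.some_injective _ h]
  exact ⟨hmax c rfl, hd⟩

lemma runUpTo_final (hα : ∀ j, mvpRun α j = some j.rev) {t : ℕ} (ht : t ≤ n) {q x : Fin n}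
    (hq : n ≤ q + t) (h : runUpTo α t q = some x) : x = q.rev := by
  have h := runUpTo_eq_some_of_forall_ne ht le_rfl h fun e he _ heq => by
    have := Fin.le_def.1 (apply_rev_eq hα e).1
    rw [heq, Fin.val_rev] at this
    omega
  rw [runUpTo_self, hα] at h
  exact (Option.some_injective _ h).symm

lemma exists_parked (hα : ∀ j, mvpRun α j = some j.rev) {t : ℕ} (ht : t ≤ n) {x : Fin n}
    (hx : x.1 < t) : ∃ z, runUpTo α t z = some x :=
  exists_runUpTo_eq_some (q := x.rev) ht le_rfl (by rw [runUpTo_self, hα, Fin.rev_rev]) hx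

/-- When the outcome is decreasing, only the car that finally parks in a spot can bump
another car from that spot. -/
lemma eq_rev_of_bump (hα : ∀ j, mvpRun α j = some j.rev) {y x : Fin n}
    (h : runUpTo α y (α y) = some x) : y = (α y).rev := by
  by_contra hne
  obtain ⟨hle, hrev⟩ := apply_rev_eq hα y
  have hlt : y < (α y).rev := lt_of_le_of_ne hle hne
  set w := α y with hw
  set c := w.rev with hc
  have hxy := lt_of_runUpTo_eq_some y.2.le h
  have hyw := runUpTo_succ_self (α := α) y
  have hyc : y.1 + 1 ≤ c.1 := hlt
  obtain ⟨j, hyj, hj⟩ := exists_le_runUpTo hyc c.2.le hyw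
  have hjc := lt_of_runUpTo_eq_some c.2.le hj
  have hblock := runUpTo_block (w := w) (x := x) hyc c.2.le (by omega) fun z hz => by
    rcases runUpTo_succ_cases hz with ⟨-, rfl⟩ | ⟨h1, h2⟩ | ⟨-, -, -, h3, h4⟩
    · exact absurd hxy (lt_irrefl _)
    · exact absurd (runUpTo_inj y.2.le h2 h) h1
    · refine ⟨h3, fun q hq hq' => ?_⟩
      rcases eq_or_lt_of_le hq' with rfl | hq'
      · simp [hz]
      rcases eq_or_lt_of_le hq with rfl | hq
      · rw [hw, hyw]; simp
      · exact runUpTo_ne_none (Nat.le_succ _) y.2 (h4 q hq hq')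
  have hc1 : c.1 + 1 ≤ n := c.2
  have hwc : w.1 + c.1 + 1 = n := by rw [hc, Fin.val_rev]; omega
  obtain ⟨zj, hzj⟩ := exists_parked hα hc1 (x := j) (by omega)
  obtain ⟨zx, hzx⟩ := exists_parked hα hc1 (x := x) (by omega)
  have hjx : x < j := Fin.lt_def.2 (by have := Fin.le_def.1 hyj; omega)
  have hzxc : runUpTo α c zx = some x := by
    rcases runUpTo_succ_cases hzx with ⟨-, rfl⟩ | ⟨-, h2⟩ | ⟨-, -, h2, -⟩
    · omega
    · exact h2
    · rw [hrev, hj] at h2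
      exact absurd (Option.some_injective _ h2) hjx.ne'
  obtain ⟨hwx, hocc⟩ := hblock zx hzxc
  rcases runUpTo_succ_cases hzj with ⟨-, rfl⟩ | ⟨h1, h2⟩ | ⟨-, h1, -, h3, -⟩
  · omega
  · rw [hrev] at h1
    exact h1 (runUpTo_inj c.2.le h2 hj)
  · rw [hrev] at h3
    have hlt : zx < zj := by
      by_contra hcon
      exact hocc zj h3.le (not_lt.1 hcon) h1
    have e1 := runUpTo_final hα hc1 (by have := Fin.lt_def.1 h3; omega) hzj
    have e2 := runUpTo_final hα hc1 (by have := Fin.lt_def.1 hwx; omega) hzx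
    rw [e1, e2, Fin.rev_lt_rev] at hjx
    exact lt_asymm hjx hlt

lemma eq_rev_of_lt_of_eq (hα : ∀ j, mvpRun α j = some j.rev) {i j : Fin n} (hij : i < j)
    (h : α i = α j) : j = (α j).rev := by
  have h1 : runUpTo α j (α j) ≠ none := by
    refine runUpTo_ne_none (t := i + 1) hij j.2.le ?_
    rw [← h, runUpTo_succ_self]
    simp
  obtain ⟨x, hx⟩ := Option.ne_none_iff_exists'.1 h1
  exact eq_rev_of_bump hα hx

lemma runUpTo_waiting (hα : ∀ j, mvpRun α j = some j.rev) {c : Fin n} {t : ℕ}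
    (hct : c.1 < t) (ht : t ≤ (α c).rev.1) : runUpTo α t (α c) = some c := by
  refine runUpTo_eq_some_of_forall_ne hct (ht.trans (Fin.is_lt _).le)
    (runUpTo_succ_self (α := α) c) fun e he het heq => ?_
  have := eq_rev_of_lt_of_eq hα (Fin.lt_def.2 he) heq.symm
  rw [heq] at this
  rw [this] at het
  omega

/-- When the last car preferring a spot arrives, the waiting car is bumped straight to its
final spot, and all spots in between carry their final occupants. -/
lemma runUpTo_bumped (hα : ∀ j, mvpRun α j = some j.rev) {c : Fin n} (hc : c < (α c).rev)
    {q : Fin n} (hq : α c < q) (hqc : q ≤ c.rev) :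
    runUpTo α ((α c).rev + 1) q = some q.rev := by
  set d := (α c).rev with hd
  have hd1 : d.1 + 1 ≤ n := d.2
  have hdv : (α c).1 + d.1 + 1 = n := by rw [hd, Fin.val_rev]; omega
  have hrev : α d = α c := (apply_rev_eq hα c).2
  have hwait : runUpTo α d (α c) = some c := runUpTo_waiting hα hc le_rfl
  have hcd := Fin.lt_def.1 hc
  obtain ⟨z, hz⟩ := exists_parked hα hd1 (x := c) (by omega)
  have hfin : runUpTo α (d + 1) q ≠ none := by
    rcases runUpTo_succ_cases hz with ⟨-, h⟩ | ⟨h1, h2⟩ | ⟨-, -, -, h3, h4⟩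
    · exact absurd h hc.ne
    · rw [hrev] at h1
      exact absurd (runUpTo_inj d.2.le h2 hwait) h1
    · rw [hrev] at h3 h4
      have := runUpTo_final hα hd1 (by have := Fin.lt_def.1 h3; omega) hz
      rw [this, Fin.rev_rev] at hqc
      rcases eq_or_lt_of_le hqc with rfl | hqc
      · simp [hz]
      · exact runUpTo_ne_none (Nat.le_succ _) hd1 (h4 q hq hqc)
  obtain ⟨x, hx⟩ := Option.ne_none_iff_exists'.1 hfin
  rw [hx, runUpTo_final hα hd1 (by have := Fin.lt_def.1 hq; omega) hx]

lemma mcount_le_two (hα : ∀ j, mvpRun α j = some j.rev) (p : Fin n) : mcount α p ≤ 2 := by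
  unfold mcount
  by_contra! hcon
  obtain ⟨a, b, c, ha, hb, hc, hab, hac, hbc⟩ := Finset.two_lt_card_iff.1 hcon
  simp only [mem_filter, mem_univ, true_and] at ha hb hc
  have key : ∀ {i j : Fin n}, α i = p → α j = p → i < j → j = p.rev := fun hi hj hij => by
    rw [← hj]
    exact eq_rev_of_lt_of_eq hα hij (hi.trans hj.symm)
  rcases lt_or_gt_of_ne hab with h1 | h1 <;> rcases lt_or_gt_of_ne hac with h2 | h2 <;>
    rcases lt_or_gt_of_ne hbc with h3 | h3 <;> grind

end Fiber

end MVPPark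

namespace MVPPark

variable {n : ℕ}

section Height

/-- The height of the path with steps `s` after its first `i` steps. -/
def height (s : Fin n → ℤ) (i : ℕ) : ℤ :=
  ∑ j ∈ univ.filter (fun j : Fin n => j.1 < i), s j

variable {s : Fin n → ℤ}

lemma height_zero : height s 0 = 0 := by
  simp [height]

lemma height_self : height s n = ∑ j, s j := by
  simp [height]

lemma height_succ (p : Fin n) : height s (p + 1) = height s p + s p := by
  unfold height
  have : (univ.filter fun j : Fin n => j.1 < p.1 + 1) =
      insert p (univ.filter fun j : Fin n => j.1 < p.1) := by
    ext j
    simp [Fin.ext_iff]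
    omega
  rw [this, sum_insert (by simp), add_comm]

lemma height_sub {v w : ℕ} (h : v ≤ w) : height s w - height s v =
    ∑ j ∈ univ.filter (fun j : Fin n => v ≤ j.1 ∧ j.1 < w), s j := by
  unfold height
  rw [sub_eq_iff_eq_add, ← sum_union]
  · congr 1
    ext j
    simp
    omega
  · rw [disjoint_left]
    simp
    omega

/-- The up step at `u` and the down step at `p` face each other in the path with heights `H`. -/
structure IsMatch (H : ℕ → ℤ) (u p : ℕ) : Prop where
  lt : u < p
  height_eq : H u = H (p + 1)
  height_lt : ∀ v, u < v → v ≤ p → H (p + 1) < H v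

namespace IsMatch

variable {H : ℕ → ℤ} {u u' p p' : ℕ}

lemma left_unique (h : IsMatch H u p) (h' : IsMatch H u' p) : u = u' := by
  rcases lt_trichotomy u u' with hlt | heq | hlt
  · exact absurd (h.height_lt u' hlt h'.lt.le) (by rw [h'.height_eq]; exact lt_irrefl _)
  · exact heq
  · exact absurd (h'.height_lt u hlt h.lt.le) (by rw [h.height_eq]; exact lt_irrefl _)

lemma right_unique (h : IsMatch H u p) (h' : IsMatch H u p') : p = p' := by
  have e := h.height_eq.symm.trans h'.height_eq
  rcases lt_trichotomy p p' with hlt | heq | hlt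
  · exact absurd (h'.height_lt (p + 1) (by have := h.lt; omega) hlt) (by rw [e]; exact lt_irrefl _)
  · exact heq
  · exact absurd (h.height_lt (p' + 1) (by have := h'.lt; omega) hlt) (by rw [e]; exact lt_irrefl _)

lemma lt_of_nested (h : IsMatch H u p) (h' : IsMatch H u' p') (hu : u < p') (hp : p' < p) :
    u < u' := by
  by_contra! hle
  rcases eq_or_lt_of_le hle with rfl | hlt
  · exact hp.ne (h'.right_unique h)
  · have h1 := h'.height_lt u hlt hu.le
    have h2 := h.height_lt (p' + 1) (by omega) hp
    rw [h.height_eq] at h1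
    exact lt_asymm h1 h2

lemma step_pos {u : Fin n} (h : IsMatch (height s) u p) : 0 < s u := by
  have h1 := h.height_lt (u + 1) (Nat.lt_succ_self _) h.lt
  rw [← h.height_eq, height_succ] at h1
  linarith

end IsMatch

lemma exists_isMatch_left {p : Fin n} (hs : ∀ j, s j ≤ 1) (hpos : 0 ≤ height s (p + 1))
    (hp : s p < 0) : ∃ u : Fin n, IsMatch (height s) u p := by
  have hsucc := height_succ (s := s) p
  have h0 : height s 0 ≤ height s (p + 1) := by rwa [height_zero]
  set u := Nat.findGreatest (fun u => height s u ≤ height s (p + 1)) p with hu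
  have hup : u ≤ p := Nat.findGreatest_le _
  have hPu : height s u ≤ height s (p + 1) :=
    Nat.findGreatest_spec (P := fun u => height s u ≤ height s (p + 1)) (Nat.zero_le p.1) h0
  have hgt : ∀ v, u < v → v ≤ p → height s (p + 1) < height s v := fun v hv hvp =>
    not_le.1 (Nat.findGreatest_is_greatest hv hvp)
  have hlt : u < p := by
    refine lt_of_le_of_ne hup fun h => ?_
    rw [h] at hPu
    linarith
  refine ⟨⟨u, hlt.trans p.2⟩, hlt, le_antisymm hPu ?_, hgt⟩
  have h1 := hgt (u + 1) (Nat.lt_succ_self u) hlt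
  have h2 := height_succ (s := s) ⟨u, hlt.trans p.2⟩
  have h3 := hs ⟨u, hlt.trans p.2⟩
  simp only at h2 ⊢
  omega

lemma exists_isMatch_right {u : Fin n} (hs : ∀ j, -1 ≤ s j) (hpos : height s n ≤ height s u)
    (hu : 0 < s u) : ∃ p : Fin n, IsMatch (height s) u p := by
  have hsucc := height_succ (s := s) u
  have hex : ∃ w, u.1 < w ∧ height s w ≤ height s u := ⟨n, u.2, hpos⟩
  obtain ⟨hw1, hw2⟩ := Nat.find_spec hex
  have hwn : Nat.find hex ≤ n := Nat.find_min' hex ⟨u.2, hpos⟩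
  have hmin : ∀ v, u.1 < v → v < Nat.find hex → height s u < height s v := fun v hv hvw => by
    have := Nat.find_min hex hvw
    push Not at this
    exact this hv
  obtain ⟨p, hp⟩ : ∃ p, Nat.find hex = p + 1 := ⟨Nat.find hex - 1, by omega⟩
  rw [hp] at hw1 hw2 hwn hmin
  have hup : u.1 < p := by
    refine lt_of_le_of_ne (by omega) fun h => ?_
    rw [← h] at hw2
    linarith
  have h1 := hmin p hup (Nat.lt_succ_self p)
  have h2 := height_succ (s := s) ⟨p, hwn⟩
  have h3 := hs ⟨p, hwn⟩
  simp only at h2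
  have heq : height s u = height s (p + 1) := by omega
  exact ⟨⟨p, hwn⟩, hup, heq, fun v hv hvp => heq ▸ hmin v hv (Nat.lt_succ_of_le hvp)⟩

end Height

section Forward

variable {α : Fin n → Fin n}

lemma stepSeq_eq (h : ∀ p, mcount α p ≤ 2) (p : Fin n) : stepSeq α p = mcount α p - 1 := by
  have := h p
  unfold stepSeq
  split_ifs <;> omega

lemma sum_stepSeq (h : ∀ p, mcount α p ≤ 2) (T : Finset (Fin n)) :
    ∑ j ∈ T, stepSeq α j = (univ.filter fun i => α i ∈ T).card - T.card := by
  have : (univ.filter fun i => α i ∈ T).card = ∑ j ∈ T, mcount α j := by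
    rw [card_eq_sum_card_fiberwise (t := T) (f := α) (by intro i; simp)]
    refine sum_congr rfl fun j hj => ?_
    unfold mcount
    congr 1
    ext i
    simp only [mem_filter, mem_univ, true_and, and_iff_right_iff_imp]
    rintro rfl
    exact hj
  simp only [stepSeq_eq h]
  rw [sum_sub_distrib, this]
  simp

lemma height_stepSeq_nonneg (hα : ∀ j, mvpRun α j = some j.rev) (i : ℕ) :
    0 ≤ height (stepSeq α) i := by
  unfold height
  rw [sum_stepSeq (mcount_le_two hα), sub_nonneg, Nat.cast_le,
    ← card_image_of_injective _ Fin.rev_injective]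
  refine card_le_card fun x hx => ?_
  simp only [mem_image, mem_filter, mem_univ, true_and] at hx ⊢
  obtain ⟨q, hq, rfl⟩ := hx
  have := Fin.le_def.1 (apply_rev_eq hα q.rev).1
  rw [Fin.val_rev, Fin.val_rev] at this
  omega

lemma sum_stepSeq_eq_zero (hα : ∀ j, mvpRun α j = some j.rev) : ∑ j, stepSeq α j = 0 := by
  rw [sum_stepSeq (mcount_le_two hα)]
  simp

lemma apply_rev_eq_of_mcount_ne_zero (hα : ∀ j, mvpRun α j = some j.rev) {p : Fin n}
    (hp : mcount α p ≠ 0) : α p.rev = p := by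
  obtain ⟨c, hc⟩ := card_ne_zero.1 hp
  simp only [mem_filter, mem_univ, true_and] at hc
  subst hc
  exact (apply_rev_eq hα c).2

lemma isMatch_apply_rev (hα : ∀ j, mvpRun α j = some j.rev) {p : Fin n}
    (hp : mcount α p = 0) : IsMatch (height (stepSeq α)) (α p.rev) p := by
  have hne : ∀ c, α c ≠ p := fun c hc => by
    have : c ∈ univ.filter fun i => α i = p := by simp [hc]
    exact card_ne_zero_of_mem this hp
  have htwo := mcount_le_two hα
  set u := α p.rev with hu
  have hle : ∀ c : Fin n, c.1 + (α c).1 + 1 ≤ n := fun c => by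
    have := Fin.le_def.1 (apply_rev_eq hα c).1
    rw [Fin.val_rev] at this
    omega
  have hpv : p.rev.1 + p.1 + 1 = n := by rw [Fin.val_rev]; omega
  have huv : u.rev.1 + u.1 + 1 = n := by rw [Fin.val_rev]; omega
  have hup : u.1 < p.1 := by
    have h1 := hle p.rev
    have h2 : u.1 ≠ p.1 := fun h => hne p.rev (Fin.ext h)
    omega
  have hlt : p.rev < (α p.rev).rev := by rw [← hu, Fin.lt_def]; omega
  have hwait : ∀ {t : ℕ}, p.rev.1 < t → t ≤ u.rev.1 → runUpTo α t u = some p.rev :=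
    fun h1 h2 => runUpTo_waiting hα h1 h2
  have hgt : ∀ v, u.1 < v → v ≤ p.1 →
      height (stepSeq α) (p + 1) < height (stepSeq α) v := by
    intro v huv' hvp
    rw [← sub_neg, height_sub (by omega), sum_stepSeq htwo, sub_neg, Nat.cast_lt,
      ← card_image_of_injective (univ.filter fun j : Fin n => v ≤ j.1 ∧ j.1 < p.1 + 1)
        Fin.rev_injective]
    refine card_lt_card ((ssubset_iff_of_subset fun c hc => ?_).2 ⟨p.rev, ?_, ?_⟩)
    · simp only [mem_filter, mem_univ, true_and, mem_image] at hc ⊢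
      refine ⟨c.rev, ?_, Fin.rev_rev c⟩
      have h1 := hle c
      have h2 : c.rev.1 + c.1 + 1 = n := by rw [Fin.val_rev]; omega
      refine ⟨by omega, ?_⟩
      by_contra hcon
      have h3 : (α c).1 ≠ p.1 := fun h => hne c (Fin.ext h)
      have h4 : (α c).rev.1 + (α c).1 + 1 = n := by rw [Fin.val_rev]; omega
      have h5 := runUpTo_bumped hα (c := c) (q := p) (Fin.lt_def.2 (by omega))
        (Fin.lt_def.2 (by omega)) (Fin.le_def.2 (by omega))
      have h6 := hwait (t := (α c).rev.1 + 1) (by omega) (by omega)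
      have := runUpTo_inj (α c).rev.2 h5 h6
      omega
    · simp only [mem_filter, mem_univ, true_and, mem_image]
      exact ⟨p, by omega, rfl⟩
    · simp only [mem_filter, mem_univ, true_and]
      omega
  refine ⟨hup, le_antisymm ?_ ?_, hgt⟩
  · rw [← sub_nonneg, height_sub (by omega), sum_stepSeq htwo, sub_nonneg, Nat.cast_le,
      ← card_image_of_injective _ Fin.rev_injective]
    refine card_le_card fun c hc => ?_
    simp only [mem_image, mem_filter, mem_univ, true_and] at hc ⊢
    obtain ⟨q, ⟨hq1, hq2⟩, rfl⟩ := hc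
    have h1 := hle q.rev
    have h2 : q.rev.1 + q.1 + 1 = n := by rw [Fin.val_rev]; omega
    refine ⟨?_, by omega⟩
    by_contra! hlt'
    have hqu : q ≠ u := by
      rintro rfl
      have := (apply_rev_eq hα p.rev).2
      rw [← hu] at this
      rw [this] at hlt'
      omega
    have hqu' : u.1 ≠ q.1 := fun h => hqu (Fin.ext h.symm)
    have h4 : (α q.rev).rev.1 + (α q.rev).1 + 1 = n := by rw [Fin.val_rev]; omega
    have h5 := runUpTo_waiting hα (c := q.rev) (t := u.rev.1 + 1) (by omega) (by omega)
    have h6 := runUpTo_bumped hα hlt (q := q) (Fin.lt_def.2 (by omega))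
      (Fin.le_def.2 (by rw [Fin.rev_rev]; omega))
    have := runUpTo_inj u.rev.2 h5 h6
    omega
  · have h1 := hgt (u + 1) (Nat.lt_succ_self _) hup
    have h2 := height_succ (s := stepSeq α) u
    have h3 : stepSeq α u ≤ 1 := by
      rw [stepSeq_eq htwo]
      have := htwo u
      omega
    omega

lemma stepSeq_injOn :
    Set.InjOn (stepSeq (n := n)) {α | ∀ j, mvpRun α j = some j.rev} := by
  intro α hα β hβ h
  have hm : ∀ p, mcount α p = mcount β p := fun p => by
    have := congrFun h p
    rw [stepSeq_eq (mcount_le_two hα), stepSeq_eq (mcount_le_two hβ)] at this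
    omega
  funext c
  rw [← Fin.rev_rev c]
  generalize c.rev = p
  by_cases hp : mcount α p = 0
  · have h1 := isMatch_apply_rev hα hp
    have h2 := isMatch_apply_rev hβ ((hm p).symm.trans hp)
    rw [← h] at h2
    exact Fin.ext (h1.left_unique h2)
  · rw [apply_rev_eq_of_mcount_ne_zero hα hp,
      apply_rev_eq_of_mcount_ne_zero hβ (hm p ▸ hp)]

end Forward

section Backward

variable {H : ℕ → ℤ} {α : Fin n → Fin n}

/-- Suppose that each car prefers either its target spot or the partner of that spot, and that
every partner is also preferred by the car targeting it. Then each car waits in its preferred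
spot until the car targeting that spot arrives, and is parked in its target spot from then on. -/
lemma runUpTo_of_isMatch
    (hα : ∀ c, α c = c.rev ∨ (IsMatch H (α c) c.rev ∧ α (α c).rev = α c)) {t : ℕ} (ht : t ≤ n) :
    ∀ x : Fin n, x.1 < t →
      runUpTo α t (if (α x).rev.1 < t then x.rev else α x) = some x := by
  have hrev : ∀ q : Fin n, q.rev.1 + q.1 + 1 = n := fun q => by rw [Fin.val_rev]; omega
  have hle : ∀ c, (α c).1 ≤ c.rev.1 := fun c => by
    rcases hα c with h | h
    · rw [h]
    · exact h.1.lt.le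
  induction t with
  | zero => simp
  | succ t ih =>
    have ih := ih (by omega)
    obtain ⟨c, hc⟩ : ∃ c : Fin n, c.1 = t := ⟨⟨t, ht⟩, rfl⟩
    subst hc
    have hself : runUpTo α (c + 1) (if (α c).rev.1 < c.1 + 1 then c.rev else α c) = some c := by
      have : (if (α c).rev.1 < c.1 + 1 then c.rev else α c) = α c := by
        split_ifs with h
        · have h1 := hle c
          have h2 := hrev c
          have h3 := hrev (α c)
          exact Fin.ext (by omega)
        · rfl
      rw [this, runUpTo_succ_self]
    have hkeep : ∀ x : Fin n, x.1 < c.1 → α x ≠ c.rev →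
        runUpTo α c (α c) ≠ some x →
        runUpTo α (c + 1) (if (α x).rev.1 < c.1 + 1 then x.rev else α x) = some x := by
      intro x hx hne hne'
      have h1 : (α x).rev.1 ≠ c.1 := fun h => hne (by rw [← Fin.ext h, Fin.rev_rev])
      have h2 : (α x).rev.1 < c.1 + 1 ↔ (α x).rev.1 < c.1 := by omega
      simp only [h2]
      have h3 := ih x hx
      rw [runUpTo_succ_of_ne_none (by rw [h3]; simp) (fun h => hne' (by rw [h, h3])), h3]
    intro x hx
    rcases Nat.lt_succ_iff_lt_or_eq.1 hx with hx | hx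
    swap
    · obtain rfl : x = c := Fin.ext hx
      exact hself
    by_cases hxc : α x = c.rev
    swap
    · by_cases hx0 : runUpTo α c (α c) = some x
      swap
      · exact hkeep x hx hxc hx0
      exfalso
      have h1 := runUpTo_inj c.2.le hx0 (ih x hx)
      have hxr := hrev x
      have hcr := hrev c
      have hlec := hle c
      split_ifs at h1 with h2
      · rw [h1] at hlec
        omega
      · rcases hα x with h3 | ⟨h3, h3'⟩
        · rw [h1, h3] at hlec
          omega
        · rcases hα c with h4 | ⟨h4, -⟩
          · exact hxc (h1.symm.trans h4)
          · rw [h1] at h4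
            have := h4.right_unique h3
            omega
    · have hxr := hrev x
      have hcr := hrev c
      rcases hα x with h3 | ⟨h3, h3'⟩
      · rw [hxc] at h3
        rw [h3] at hcr
        omega
      have hαc : α c = c.rev := by rwa [hxc, Fin.rev_rev] at h3'
      rw [hxc] at h3
      have hwait := ih x hx
      rw [hxc, Fin.rev_rev, if_neg (lt_irrefl _)] at hwait
      rw [hxc, Fin.rev_rev, if_pos (Nat.lt_succ_self _), runUpTo_succ, hαc,
        mvpStep_of_eq_some (k := x.rev) hwait h3.lt]
      · simp
      · by_contra hcon
        obtain ⟨y, hy⟩ := Option.ne_none_iff_exists'.1 hcon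
        have hyc := lt_of_runUpTo_eq_some c.2.le hy
        have h5 := runUpTo_inj c.2.le hy (ih y hyc)
        split_ifs at h5 with h6
        · obtain rfl := Fin.rev_injective h5
          rw [hxc, Fin.rev_rev] at h6
          exact lt_irrefl _ h6
        · have := hrev (α y)
          rw [← h5] at h6 this
          omega
      · intro q hcq hqx
        have hcq := Fin.lt_def.1 hcq
        have hqx' := Fin.lt_def.1 hqx
        have hq := hrev q
        have h5 := ih q.rev (by omega)
        have h6 : c.rev.1 < (α q.rev).1 := by
          rcases hα q.rev with h7 | ⟨h7, -⟩
          · rwa [h7, Fin.rev_rev]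
          · rw [Fin.rev_rev] at h7
            exact h3.lt_of_nested h7 hcq hqx'
        have h7 := hrev (α q.rev)
        rw [if_pos (by omega), Fin.rev_rev] at h5
        simp [h5]

lemma exists_stepSeq_eq {s : Fin n → ℤ} (hs : ∀ j, s j = -1 ∨ s j = 0 ∨ s j = 1)
    (hpos : ∀ i : ℕ, 1 ≤ i → i ≤ n → 0 ≤ height s i) (hzero : ∑ j, s j = 0) :
    ∃ α : Fin n → Fin n, (∀ j, mvpRun α j = some j.rev) ∧ stepSeq α = s := by
  have hex : ∀ p : Fin n, ∃ a : Fin n,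
      (0 ≤ s p → a = p) ∧ (s p < 0 → IsMatch (height s) a p) := fun p => by
    by_cases hp : s p < 0
    · obtain ⟨u, hu⟩ := exists_isMatch_left (fun j => by rcases hs j with h | h | h <;> omega)
        (hpos (p + 1) (by omega) p.2) hp
      exact ⟨u, fun h => absurd hp (not_lt.2 h), fun _ => hu⟩
    · exact ⟨p, fun _ => rfl, fun h => absurd h hp⟩
  choose f hf hf' using hex
  have hright : ∀ u : Fin n, 0 < s u → ∃ p : Fin n, IsMatch (height s) u p := fun u hu => by
    refine exists_isMatch_right (fun j => by rcases hs j with h | h | h <;> omega) ?_ hu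
    rw [height_self, hzero]
    rcases Nat.eq_zero_or_pos u.1 with h | h
    · rw [h, height_zero]
    · exact hpos u h u.2.le
  have hneg : ∀ {u p : Fin n}, IsMatch (height s) u p → s p < 0 := fun {u p} h => by
    have h1 := height_succ (s := s) p
    have h2 := h.height_lt p h.lt le_rfl
    omega
  have hstep : ∀ p, s p < 0 → 0 < s (f p) := fun p hp => (hf' p hp).step_pos
  refine ⟨fun c => f c.rev, fun j => ?_, funext fun j => ?_⟩
  · have := runUpTo_of_isMatch (H := height s) (α := fun c => f c.rev) (fun c => ?_) le_rfl
      j.rev j.rev.2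
    · rwa [if_pos (Fin.is_lt _), Fin.rev_rev, runUpTo_self] at this
    · rcases lt_or_ge (s c.rev) 0 with h | h
      · right
        refine ⟨hf' _ h, ?_⟩
        simp only [Fin.rev_rev]
        exact hf _ (hstep _ h).le
      · exact .inl (hf _ h)
  · have hcard : mcount (fun c : Fin n => f c.rev) j = (univ.filter fun p => f p = j).card := by
      unfold mcount
      refine card_bij' (fun c _ => c.rev) (fun c _ => c.rev) ?_ ?_ ?_ ?_ <;> simp
    unfold stepSeq
    rw [hcard]
    rcases hs j with h | h | h
    · have : (univ.filter fun p => f p = j) = ∅ := by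
        ext p
        simp only [mem_filter, mem_univ, true_and, notMem_empty, iff_false]
        rintro rfl
        rcases lt_or_ge (s p) 0 with h' | h'
        · have := hstep p h'
          omega
        · rw [hf p h'] at h
          omega
      simp [this, h]
    · have : (univ.filter fun p => f p = j) = {j} := by
        ext p
        simp only [mem_filter, mem_univ, true_and, mem_singleton]
        refine ⟨?_, ?_⟩
        · rintro rfl
          rcases lt_or_ge (s p) 0 with h' | h'
          · have := hstep p h'
            omega
          · exact (hf p h').symm
        · rintro rfl
          exact hf p h.ge
      simp [this, h]
    · obtain ⟨r, hr⟩ := hright j (by omega)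
      have : (univ.filter fun p => f p = j) = {j, r} := by
        ext p
        simp only [mem_filter, mem_univ, true_and, mem_singleton, mem_insert]
        refine ⟨?_, ?_⟩
        · rintro rfl
          rcases lt_or_ge (s p) 0 with h' | h'
          · exact .inr (Fin.ext ((hf' p h').right_unique hr))
          · exact .inl (hf p h').symm
        · rintro (rfl | rfl)
          · exact hf p (by omega)
          · exact Fin.ext ((hf' p (hneg hr)).left_unique hr)
      have hjr : j ≠ r := Fin.ne_of_lt (Fin.lt_def.2 hr.lt)
      simp [this, h, card_pair hjr]

end Backward

end MVPPark

open MVPPark in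
/-- The map `α ↦ s(α)` is a bijection from the fiber of the MVP outcome map over the
decreasing permutation `w₀` onto the set of Motzkin step sequences of length `n`. -/
theorem stepSeq_bijOn (n : ℕ) (hn : 1 ≤ n) :
    Set.BijOn (fun α : Fin n → Fin n => stepSeq α)
      {α : Fin n → Fin n | ∀ j : Fin n, mvpRun α j = some j.rev}
      {s : Fin n → ℤ |
        (∀ j : Fin n, s j = -1 ∨ s j = 0 ∨ s j = 1) ∧
        (∀ i : ℕ, 1 ≤ i → i ≤ n →
          0 ≤ ∑ j ∈ Finset.univ.filter (fun j : Fin n => j.1 < i), s j) ∧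
        ∑ j : Fin n, s j = 0} := by
  have hinj := stepSeq_injOn (n := n)
  refine ⟨fun α hα => ⟨fun j => ?_, fun i _ _ => height_stepSeq_nonneg hα i,
    sum_stepSeq_eq_zero hα⟩, hinj, fun s ⟨hs, hpos, hzero⟩ => exists_stepSeq_eq hs hpos hzero⟩
  simp only [stepSeq]
  split_ifs <;> simp
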